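/- Continuous-time Lyapunov property of dual averaging: let θ : [0,∞) → ℝ^d be a C¹ solution of the dual averaging ODE d/dt[∇h(θ(t)) + t∇g(θ(t))] = −∇f(θ(t)), with f, g, h convex and differentiable. Then for any minimizer θ_* of ψ = f + g, the function t ↦ D_{h+tg}(θ_*, θ(t)) satisfies d/dt D_{h+tg}(θ_*, θ(t)) = g(θ_*) − g(θ(t)) − ⟨∇f(θ(t)), θ(t) − θ_*⟩ ≤ ψ(θ_*) − ψ(θ(t)) ≤ 0; consequently, for the running average θ̄(t) = (1/t)∫₀ᵗ θ(s) ds, ψ(θ̄(t)) − ψ(θ_*) ≤ D_h(θ_*, θ(0))/t. -/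

import Mathlib

open scoped RealInnerProductSpace

section ConvexGradient

open Filter Topology

variable {E : Type*} [NormedAddCommGroup E] [InnerProductSpace ℝ E] [CompleteSpace E]

/-- A convex function lies above each of its tangent hyperplanes. -/
theorem ConvexOn.inner_gradient_le_sub {k : E → ℝ} {v x : E} (hk : ConvexOn ℝ Set.univ k)
    (hv : HasGradientAt k v x) (y : E) : ⟪v, y - x⟫ ≤ k y - k x := by
  have hline : HasDerivAt (fun r : ℝ => AffineMap.lineMap x y r) (y - x) (0 : ℝ) :=
    AffineMap.hasDerivAt_lineMap
  have hd : HasDerivAt (fun r : ℝ => k (AffineMap.lineMap x y r)) ⟪v, y - x⟫ 0 := by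
    have hv' : HasFDerivAt k (InnerProductSpace.toDual ℝ E v) (AffineMap.lineMap x y (0 : ℝ)) := by
      simpa using hv.hasFDerivAt
    exact (hv'.comp_hasDerivAt (0 : ℝ) hline).congr_deriv (by simp)
  have hc : ConvexOn ℝ Set.univ (fun r : ℝ => k (AffineMap.lineMap x y r)) := by
    simpa [Function.comp_def] using hk.comp_affineMap (AffineMap.lineMap x y)
  have := hc.le_slope_of_hasDerivAt (Set.mem_univ 0) (Set.mem_univ 1) one_pos hd
  simpa [slope_def_field] using this

/-- The gradient of a differentiable convex function is continuous. -/
theorem ConvexOn.continuous_gradient {k : E → ℝ} {k' : E → E} (hk : ConvexOn ℝ Set.univ k)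
    (hk' : ∀ x, HasGradientAt k (k' x) x) : Continuous k' := by
  rw [continuous_iff_continuousAt]
  intro x
  rw [Metric.continuousAt_iff]
  intro ε hε
  have hlo := (hasGradientAt_iff_isLittleO.1 (hk' x)).def (c := ε / 3) (by positivity)
  obtain ⟨δ, hδ, hball⟩ := Metric.eventually_nhds_iff.1 hlo
  refine ⟨δ / 2, by positivity, fun {y} hy => ?_⟩
  rcases eq_or_ne (k' y) (k' x) with heq | hne
  · simpa [heq] using hε
  rcases eq_or_ne y x with rfl | hyx
  · exact absurd rfl hne
  have hr : 0 < ‖y - x‖ := norm_pos_iff.2 (sub_ne_zero.2 hyx)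
  have hw : 0 < ‖k' y - k' x‖ := norm_pos_iff.2 (sub_ne_zero.2 hne)
  set r := ‖y - x‖ with hr_def
  set u := (r * ‖k' y - k' x‖⁻¹) • (k' y - k' x) with hu_def
  have hu : ‖u‖ = r := by
    rw [hu_def, norm_smul, Real.norm_of_nonneg (by positivity), mul_assoc,
      inv_mul_cancel₀ hw.ne', mul_one]
  have hyr : r < δ / 2 := by simpa [dist_eq_norm] using hy
  have hnorm : ‖y + u - x‖ ≤ 2 * r := by
    calc ‖y + u - x‖ = ‖(y - x) + u‖ := by congr 1; abel
      _ ≤ ‖y - x‖ + ‖u‖ := norm_add_le _ _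
      _ = 2 * r := by rw [hu]; ring
  have h1 := hball (y := y + u) (by rw [dist_eq_norm]; linarith)
  have h2 := (le_abs_self _).trans h1
  have h3 := hk.inner_gradient_le_sub (hk' y) (y + u)
  have h4 := hk.inner_gradient_le_sub (hk' x) y
  have h5 : ⟪k' y - k' x, u⟫ = r * ‖k' y - k' x‖ := by
    rw [hu_def, inner_smul_right, real_inner_self_eq_norm_sq]
    field_simp
  have h6 : y + u - x = (y - x) + u := by abel
  rw [add_sub_cancel_left] at h3
  rw [inner_sub_left] at h5
  have h7 : ε / 3 * ‖y + u - x‖ ≤ ε / 3 * (2 * r) := by gcongr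
  rw [h6, inner_add_right, ← h6] at h2
  rw [dist_eq_norm]
  have h8 : r * ‖k' y - k' x‖ < r * ε := by nlinarith
  exact lt_of_mul_lt_mul_left h8 hr.le

/-- Differentiating the Bregman divergence in its second argument along a continuous curve needs
only the gradient along the curve to be differentiable, not the curve itself. -/
theorem ConvexOn.hasDerivAt_bregman {k : E → ℝ} {k' : E → E} (hk : ConvexOn ℝ Set.univ k)
    (hk' : ∀ x, HasGradientAt k (k' x) x) {θ : ℝ → E} {t : ℝ} (hθ : ContinuousAt θ t) {q : E}
    (hq : HasDerivAt (fun s => k' (θ s)) q t) (z : E) :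
    HasDerivAt (fun s => k z - k (θ s) - ⟪k' (θ s), z - θ s⟫) (-⟪q, z - θ t⟫) t := by
  have hrem : HasDerivAt (fun s => k (θ t) - k (θ s) - ⟪k' (θ s), θ t - θ s⟫) 0 t := by
    rw [hasDerivAt_iff_isLittleO]
    have hO : (fun s => k' (θ s) - k' (θ t)) =O[𝓝 t] fun s => s - t := hq.isBigO_sub
    have ho : (fun s => θ s - θ t) =o[𝓝 t] fun _ => (1 : ℝ) := by
      rw [Asymptotics.isLittleO_one_iff]
      simpa using hθ.tendsto.sub_const (θ t)
    have hprod := hO.norm_left.mul_isLittleO ho.norm_left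
    simp only [mul_one] at hprod
    refine (Asymptotics.IsBigO.of_bound 1 (Eventually.of_forall fun s => ?_)).trans_isLittleO hprod
    have h1 := hk.inner_gradient_le_sub (hk' (θ s)) (θ t)
    have h2 := hk.inner_gradient_le_sub (hk' (θ t)) (θ s)
    have h3 := real_inner_le_norm (k' (θ s) - k' (θ t)) (θ s - θ t)
    simp only [sub_self, inner_zero_right, smul_zero, sub_zero, one_mul, norm_mul, norm_norm]
    rw [Real.norm_of_nonneg (by linarith)]
    rw [inner_sub_left, ← neg_sub (θ t) (θ s), inner_neg_right, inner_neg_right, norm_neg,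
      norm_sub_rev (θ t)] at h3
    rw [← neg_sub (θ t) (θ s), inner_neg_right] at h2
    linarith
  have hlin := (hq.inner ℝ (hasDerivAt_const t (z - θ t))).const_sub (k z - k (θ t))
  refine ((hrem.add hlin).congr_of_eventuallyEq (.of_forall fun s => ?_)).congr_deriv ?_
  · have : z - θ s = (z - θ t) + (θ t - θ s) := by abel
    simp only [Pi.add_apply]
    rw [this, inner_add_right]
    ring
  · simp

end ConvexGradient

theorem HasDerivAt.sub_smul_of_continuousAt {F : Type*} [NormedAddCommGroup F] [NormedSpace ℝ F]
    {c : ℝ → F} {t : ℝ} (hc : ContinuousAt c t) :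
    HasDerivAt (fun s => (s - t) • c s) (c t) t := by
  rw [hasDerivAt_iff_tendsto_slope]
  refine (hc.tendsto.mono_left nhdsWithin_le_nhds).congr' ?_
  filter_upwards [self_mem_nhdsWithin] with s hs
  have : s - t ≠ 0 := sub_ne_zero.2 hs
  simp [slope_def_module, smul_smul, this]

/-- Continuous-time Lyapunov property of dual averaging: along a solution of
`d/dt[∇h(θ(t)) + t∇g(θ(t))] = −∇f(θ(t))`, the Bregman divergence
`D_{h+tg}(θ_*, θ(t))` has derivative
`g(θ_*) − g(θ(t)) − ⟨∇f(θ(t)), θ(t) − θ_*⟩ ≤ ψ(θ_*) − ψ(θ(t)) ≤ 0`, and the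
running average satisfies `ψ(θ̄(t)) − ψ(θ_*) ≤ D_h(θ_*, θ(0))/t`. -/
theorem stmt_19 {d : ℕ}
    (f g h : EuclideanSpace ℝ (Fin d) → ℝ)
    (f' g' h' : EuclideanSpace ℝ (Fin d) → EuclideanSpace ℝ (Fin d))
    (hfc : ConvexOn ℝ Set.univ f) (hgc : ConvexOn ℝ Set.univ g)
    (hhc : ConvexOn ℝ Set.univ h)
    (hf' : ∀ x, HasGradientAt f (f' x) x)
    (hg' : ∀ x, HasGradientAt g (g' x) x)
    (hh' : ∀ x, HasGradientAt h (h' x) x)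
    (θ : ℝ → EuclideanSpace ℝ (Fin d)) (hθcont : Continuous θ)
    (hode : ∀ t : ℝ, 0 ≤ t →
      HasDerivAt (fun s : ℝ => h' (θ s) + s • g' (θ s)) (-(f' (θ t))) t)
    (θs : EuclideanSpace ℝ (Fin d))
    (hmin : ∀ x, f θs + g θs ≤ f x + g x) :
    ∀ t : ℝ, 0 ≤ t →
      (HasDerivAt
          (fun s : ℝ =>
            (h θs + s * g θs) - (h (θ s) + s * g (θ s))
              - ⟪h' (θ s) + s • g' (θ s), θs - θ s⟫)
          (g θs - g (θ t) - ⟪f' (θ t), θ t - θs⟫) t)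
      ∧ g θs - g (θ t) - ⟪f' (θ t), θ t - θs⟫
          ≤ (f θs + g θs) - (f (θ t) + g (θ t))
      ∧ (f θs + g θs) - (f (θ t) + g (θ t)) ≤ 0
      ∧ (0 < t →
          (f (t⁻¹ • ∫ s in (0 : ℝ)..t, θ s) + g (t⁻¹ • ∫ s in (0 : ℝ)..t, θ s))
              - (f θs + g θs)
            ≤ (h θs - h (θ 0) - ⟪h' (θ 0), θs - θ 0⟫) / t) := by
  have hf0 := fun x y => hfc.inner_gradient_le_sub (hf' x) y
  have hg0 := fun x y => hgc.inner_gradient_le_sub (hg' x) y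
  have hh0 := fun x y => hhc.inner_gradient_le_sub (hh' x) y
  have hg'c : Continuous g' := hgc.continuous_gradient hg'
  have hgcont : Continuous g :=
    continuous_iff_continuousAt.2 fun x => (hg' x).continuousAt
  have hderiv : ∀ t : ℝ, 0 ≤ t → HasDerivAt
      (fun s : ℝ => (h θs + s * g θs) - (h (θ s) + s * g (θ s))
        - ⟪h' (θ s) + s • g' (θ s), θs - θ s⟫)
      (g θs - g (θ t) - ⟪f' (θ t), θ t - θs⟫) t := by
    intro t ht
    have hk : ConvexOn ℝ Set.univ (fun x => h x + t * g x) := hhc.add (hgc.smul ht)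
    have hk' : ∀ x, HasGradientAt (fun x => h x + t * g x) (h' x + t • g' x) x := fun x => by
      rw [hasGradientAt_iff_hasFDerivAt]
      exact ((hh' x).hasFDerivAt.add ((hg' x).hasFDerivAt.const_mul t)).congr_fderiv (by simp)
    have hq : HasDerivAt (fun s => h' (θ s) + t • g' (θ s)) (-f' (θ t) - g' (θ t)) t := by
      refine ((hode t ht).sub (HasDerivAt.sub_smul_of_continuousAt
        (hg'c.comp hθcont).continuousAt)).congr_of_eventuallyEq (.of_forall fun s => ?_)
      simp only [Pi.sub_apply, Function.comp_apply, sub_smul]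
      abel
    have hmain := hk.hasDerivAt_bregman hk' hθcont.continuousAt hq θs
    have hrest : HasDerivAt
        (fun s => (s - t) • (g θs - g (θ s) - ⟪g' (θ s), θs - θ s⟫))
        (g θs - g (θ t) - ⟪g' (θ t), θs - θ t⟫) t :=
      HasDerivAt.sub_smul_of_continuousAt
        (c := fun s => g θs - g (θ s) - ⟪g' (θ s), θs - θ s⟫) (by fun_prop)
    refine ((hmain.add hrest).congr_of_eventuallyEq (.of_forall fun s => ?_)).congr_deriv ?_
    · simp only [Pi.add_apply, inner_add_left, real_inner_smul_left, smul_eq_mul]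
      ring
    · rw [← neg_sub θs (θ t)]
      simp only [inner_sub_left, inner_neg_left, inner_neg_right]
      ring
  intro t ht
  refine ⟨hderiv t ht, ?_, by linarith [hmin (θ t)], fun htpos => ?_⟩
  · have := hf0 (θ t) θs
    rw [← neg_sub θs (θ t), inner_neg_right]
    linarith
  set m := t⁻¹ • ∫ s in (0 : ℝ)..t, θ s with hm
  have hI : ∀ s, HasDerivAt (fun s => ∫ r in (0 : ℝ)..s, θ r) (θ s) s := fun s =>
    (hθcont.integral_hasStrictDerivAt 0 s).hasDerivAt
  have hlin : ∀ s : ℝ, HasDerivAt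
      (fun s => s * (f m + g m - (f θs + g θs)) + ⟪f' m + g' m, (∫ r in (0 : ℝ)..s, θ r) - s • m⟫)
      (f m + g m - (f θs + g θs) + ⟪f' m + g' m, θ s - m⟫) s := fun s => by
    have hsm : HasDerivAt (fun s : ℝ => s • m) m s := by
      simpa using (hasDerivAt_id s).smul_const m
    exact (((hasDerivAt_id s).mul_const (f m + g m - (f θs + g θs))).add
      ((hasDerivAt_const s (f' m + g' m)).inner ℝ ((hI s).sub hsm))).congr_deriv (by simp)
  have hG := fun s hs => (hderiv s hs).add (hlin s)
  have hanti := antitoneOn_of_hasDerivWithinAt_nonpos (convex_Icc 0 t)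
    (fun s hs => (hG s hs.1).continuousAt.continuousWithinAt)
    (fun s hs => (hG s (interior_subset hs).1).hasDerivWithinAt) (fun s _ => by
      have h1 := hf0 (θ s) θs
      have h2 := hf0 m (θ s)
      have h3 := hg0 m (θ s)
      rw [← neg_sub θs (θ s), inner_neg_right, inner_add_left]
      linarith)
  have hle := hanti (Set.left_mem_Icc.2 ht) (Set.right_mem_Icc.2 ht) ht
  have htm : t • m = ∫ s in (0 : ℝ)..t, θ s := by
    rw [hm, smul_inv_smul₀ htpos.ne']
  simp only [Pi.add_apply, htm, sub_self, inner_zero_right, intervalIntegral.integral_same,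
    zero_mul, zero_smul, add_zero, inner_add_left, real_inner_smul_left] at hle
  have h1 := hh0 (θ t) θs
  have h2 := mul_le_mul_of_nonneg_left (hg0 (θ t) θs) ht
  rw [le_div_iff₀ htpos]
  linarith
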